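/- Let α ∈ (0,1) be irrational, ρ ∈ [0,1), let s = s_{α,ρ} be the Sturmian word of slope α and intercept ρ, and let ℓ ≥ 1. Then the shifted ℓ-boundary sequence n ↦ ∂_{s,ℓ}[n+ℓ+1] (n ≥ 0) is uniformly recurrent, and the full ℓ-boundary sequence n ↦ ∂_{s,ℓ}[n+ℓ] (n ≥ 0) is uniformly recurrent if and only if 0^{2ℓ} or 1^{2ℓ} appears as a factor of s. -/

import Mathlib

/-- The Sturmian word of slope `α` and intercept `ρ`:
`s[n] = 0` iff `{ρ + nα} ∈ [0, 1−α)`. -/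
noncomputable def sturmian (α ρ : ℝ) (n : ℕ) : Fin 2 :=
  if Int.fract (ρ + n * α) < 1 - α then 0 else 1

/-- The `n`-th boundary set of the infinite word `x` with window length `ℓ`. -/
def boundarySet {A : Type*} (x : ℕ → A) (ℓ n : ℕ) :
    Set ((Fin ℓ → A) × (Fin ℓ → A)) :=
  {p | ∃ i : ℕ, (∀ k : Fin ℓ, p.1 k = x (i + k)) ∧ (∀ k : Fin ℓ, p.2 k = x (i + n + k))}

/-- An infinite word `y` is uniformly recurrent if each of its factors occurs with
bounded gaps: for all `m, n` there is `C` such that every length-`C` window of `y`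
contains an occurrence of the factor `y[m] ⋯ y[m+n−1]`. -/
def UniformlyRecurrent {Λ : Type*} (y : ℕ → Λ) : Prop :=
  ∀ m n : ℕ, ∃ C : ℕ, ∀ i : ℕ, ∃ j : ℕ,
    i ≤ j ∧ j + n ≤ i + C ∧ ∀ k < n, y (j + k) = y (m + k)

open Filter Topology in
lemma exists_pos_forall_of_antitone {ι : Type*} [Finite ι] {P : ι → ℝ → Prop}
    (mono : ∀ i ε ε', ε' ≤ ε → P i ε → P i ε') (h : ∀ i, ∃ ε > 0, P i ε) :
    ∃ ε > 0, ∀ i, P i ε := by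
  have key : ∀ i, ∀ᶠ ε in 𝓝[>] (0 : ℝ), P i ε := fun i => by
    obtain ⟨ε, hε, hP⟩ := h i
    filter_upwards [Ioc_mem_nhdsGT hε] with x hx
    exact mono i ε x hx.2 hP
  obtain ⟨ε, h1, h2⟩ := ((eventually_all.2 key).and self_mem_nhdsWithin).exists
  exact ⟨ε, h2, h1⟩

/-- Every orbit of an irrational rotation enters `[0, ε)` within a bounded time. -/
lemma exists_fract_add_mul_lt {β : ℝ} (hβ : Irrational β) {ε : ℝ} (hε : 0 < ε) :
    ∃ C : ℕ, ∀ x : ℝ, ∃ j ≤ C, Int.fract (x + j * β) < ε := by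
  obtain ⟨n, hn⟩ := exists_nat_one_div_lt hε
  obtain ⟨q, hq, -, hqβ⟩ := Real.exists_nat_abs_mul_sub_round_le β (Nat.succ_pos n)
  set p := round (q * β)
  set θ := q * β - p with hθ
  have hθε : |θ| < ε := by
    refine hqβ.trans_lt (lt_of_le_of_lt ?_ hn)
    push_cast
    gcongr
    linarith
  have hθ0 : θ ≠ 0 := by
    have := (hβ.natCast_mul hq.ne').ne_int p
    exact sub_ne_zero.2 this
  have step : ∀ (x : ℝ) (j : ℕ) (N : ℤ), (N : ℝ) ≤ x + j * θ → x + j * θ < N + ε →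
      Int.fract (x + (j * q : ℕ) * β) < ε := by
    intro x j N h1 h2
    have e : x + ((j * q : ℕ) : ℝ) * β = (x + j * θ - N) + ((N + j * p : ℤ) : ℝ) := by
      push_cast [hθ]; ring
    rw [e, Int.fract_add_intCast]
    rcases lt_or_ge (x + j * θ - N) 1 with h | h
    · rw [Int.fract_eq_self.2 ⟨by linarith, h⟩]; linarith
    · linarith [Int.fract_lt_one (x + j * θ - N)]
  refine ⟨⌈1 / |θ|⌉₊ * q, fun x => ?_⟩
  have hpos : 0 < |θ| := abs_pos.2 hθ0
  rcases lt_or_gt_of_ne hθ0 with h | h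
  · have ha : |θ| = -θ := abs_of_neg h
    set j := ⌊Int.fract x / |θ|⌋₊
    have h1 : (j : ℝ) ≤ Int.fract x / |θ| :=
      Nat.floor_le (div_nonneg (Int.fract_nonneg x) hpos.le)
    have h2 : Int.fract x / |θ| < j + 1 := Nat.lt_floor_add_one _
    rw [le_div_iff₀ hpos] at h1
    rw [div_lt_iff₀ hpos] at h2
    refine ⟨j * q, Nat.mul_le_mul_right _ ?_, step x j ⌊x⌋ ?_ ?_⟩
    · refine (Nat.floor_le_ceil _).trans (Nat.ceil_mono ?_)
      gcongr
      exact (Int.fract_lt_one x).le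
    · rw [ha] at h1; linarith [Int.floor_add_fract x]
    · rw [ha] at h2 hθε; linarith [Int.floor_add_fract x]
  · have ha : |θ| = θ := abs_of_pos h
    set j := ⌈(⌈x⌉ - x) / |θ|⌉₊
    have h0 : 0 ≤ ⌈x⌉ - x := by linarith [Int.le_ceil x]
    have h1 : (⌈x⌉ - x) / |θ| ≤ j := Nat.le_ceil _
    have h2 : (j : ℝ) < (⌈x⌉ - x) / |θ| + 1 := Nat.ceil_lt_add_one (div_nonneg h0 hpos.le)
    rw [div_le_iff₀ hpos] at h1
    rw [← sub_lt_iff_lt_add, lt_div_iff₀ hpos] at h2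
    refine ⟨j * q, Nat.mul_le_mul_right _ ?_, step x j ⌈x⌉ ?_ ?_⟩
    · refine Nat.ceil_mono ?_
      gcongr
      linarith [Int.ceil_lt_add_one x]
    · rw [ha] at h1; linarith
    · rw [ha] at h2 hθε; linarith

lemma UniformlyRecurrent.of_rotation {Λ : Type*} {F : ℝ → Λ} {α : ℝ} (hα : Irrational α)
    (hper : ∀ (t : ℝ) (m : ℤ), F (t + m) = F t) (c : ℕ) {σ : ℤ} (hσ : σ = 1 ∨ σ = -1)
    (h : ∀ n : ℕ, ∃ ε > 0, ∀ δ : ℝ, 0 ≤ δ → δ < ε →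
      F ((n + c : ℕ) * α + σ * δ) = F ((n + c : ℕ) * α)) :
    UniformlyRecurrent (fun n : ℕ => F ((n + c : ℕ) * α)) := by
  intro m N
  obtain ⟨ε, hε, hF⟩ := exists_pos_forall_of_antitone (ι := Fin N)
    (P := fun k ε => ∀ δ : ℝ, 0 ≤ δ → δ < ε →
      F ((m + k + c : ℕ) * α + σ * δ) = F ((m + k + c : ℕ) * α))
    (fun i ε ε' hle hP δ h0 h1 => hP δ h0 (h1.trans_le hle)) (fun k => h (m + k))
  have hσα : Irrational (σ * α) := hα.intCast_mul (by rcases hσ with rfl | rfl <;> decide)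
  obtain ⟨C, hC⟩ := exists_fract_add_mul_lt hσα hε
  refine ⟨C + N, fun i => ?_⟩
  obtain ⟨j, hj, hlt⟩ := hC ((i - m) * (σ * α))
  refine ⟨i + j, by omega, by omega, fun k hk => ?_⟩
  set x : ℝ := (i - m) * (σ * α) + j * (σ * α) with hx
  have e := hF ⟨k, hk⟩ (Int.fract x) (Int.fract_nonneg x) hlt
  have hsq : (σ : ℝ) * σ = 1 := by rcases hσ with rfl | rfl <;> norm_num
  have : ((i + j + k + c : ℕ) : ℝ) * α =
      ((m + k + c : ℕ) * α + σ * Int.fract x) + ((σ * ⌊x⌋ : ℤ) : ℝ) := by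
    have : σ * Int.fract x + σ * ⌊x⌋ = (i - m + j) * α := by
      rw [← mul_add, add_comm, Int.floor_add_fract, hx]
      linear_combination (i - m + j) * α * hsq
    push_cast
    linear_combination -this
  simp only [this, hper]
  exact e

/-- The letter coding the point `x` of the circle. -/
noncomputable def circleLetter (α x : ℝ) : Fin 2 := if Int.fract x < 1 - α then 0 else 1

/-- The word of length `ℓ` coding the orbit of `x` under the rotation by `α`. -/
noncomputable def circleWord (α : ℝ) (ℓ : ℕ) (x : ℝ) : Fin ℓ → Fin 2 :=
  fun k => circleLetter α (x + k * α)

/-- The pairs of words coding two points of the circle that differ by `t`. -/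
def circlePairs (α : ℝ) (ℓ : ℕ) (t : ℝ) : Set ((Fin ℓ → Fin 2) × (Fin ℓ → Fin 2)) :=
  {p | ∃ x : ℝ, p.1 = circleWord α ℓ x ∧ p.2 = circleWord α ℓ (x + t)}

lemma circleLetter_eq_zero_iff {α : ℝ} (hα0 : 0 < α) (x : ℝ) :
    circleLetter α x = 0 ↔ ⌊x + α⌋ = ⌊x⌋ := by
  unfold circleLetter
  have hf := Int.floor_add_fract x
  have h0 := Int.fract_nonneg x
  rw [Int.floor_eq_iff]
  split_ifs with h
  · simp only [true_iff]
    constructor <;> linarith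
  · simp only [one_ne_zero, false_iff, not_and, not_lt]
    intro; linarith

lemma floor_add_eq_or {α : ℝ} (hα0 : 0 < α) (hα1 : α < 1) (x : ℝ) :
    ⌊x + α⌋ = ⌊x⌋ ∨ ⌊x + α⌋ = ⌊x⌋ + 1 := by
  have h1 : ⌊x⌋ ≤ ⌊x + α⌋ := Int.floor_mono (by linarith)
  have h2 : ⌊x + α⌋ ≤ ⌊x + 1⌋ := Int.floor_mono (by linarith)
  rw [Int.floor_add_one] at h2
  omega

lemma circleLetter_eq_one_iff {α : ℝ} (hα0 : 0 < α) (hα1 : α < 1) (x : ℝ) :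
    circleLetter α x = 1 ↔ ⌊x + α⌋ = ⌊x⌋ + 1 := by
  have h := circleLetter_eq_zero_iff hα0 x
  have h' := floor_add_eq_or hα0 hα1 x
  have : circleLetter α x = 1 ↔ ¬ circleLetter α x = 0 := by
    generalize circleLetter α x = a
    revert a; decide
  rw [this, h]
  omega

lemma circleLetter_eq_iff {α : ℝ} (hα0 : 0 < α) (hα1 : α < 1) (x y : ℝ) :
    circleLetter α x = circleLetter α y ↔ ⌊x + α⌋ - ⌊x⌋ = ⌊y + α⌋ - ⌊y⌋ := by
  have h0 := circleLetter_eq_zero_iff hα0 y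
  have h1 := circleLetter_eq_one_iff hα0 hα1 y
  rcases floor_add_eq_or hα0 hα1 x with h | h
  · rw [(circleLetter_eq_zero_iff hα0 x).2 h, eq_comm, h0]; omega
  · rw [(circleLetter_eq_one_iff hα0 hα1 x).2 h, eq_comm, h1]; omega

lemma circleWord_eq_iff {α : ℝ} (hα0 : 0 < α) (hα1 : α < 1) (ℓ : ℕ) (x y : ℝ) :
    circleWord α ℓ x = circleWord α ℓ y ↔
      ∀ k : ℕ, k ≤ ℓ → ⌊x + k * α⌋ - ⌊x⌋ = ⌊y + k * α⌋ - ⌊y⌋ := by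
  have e : ∀ (z : ℝ) (k : ℕ), z + k * α + α = z + (k + 1 : ℕ) * α := fun z k => by
    push_cast; ring
  have hl : ∀ k : ℕ, circleLetter α (x + k * α) = circleLetter α (y + k * α) ↔
      ⌊x + (k + 1 : ℕ) * α⌋ - ⌊x + k * α⌋ = ⌊y + (k + 1 : ℕ) * α⌋ - ⌊y + k * α⌋ := fun k => by
    rw [circleLetter_eq_iff hα0 hα1, e, e]
  constructor
  · intro h k
    induction k with
    | zero => simp
    | succ k ih =>
      intro hk
      have h1 := ih (by omega)
      have h2 := (hl k).1 (congrFun h ⟨k, hk⟩)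
      omega
  · intro h
    funext k
    have h1 := h k k.2.le
    have h2 := h (k + 1) k.2
    exact (hl k).2 (by omega)

lemma circleWord_add_intCast (α : ℝ) (ℓ : ℕ) (x : ℝ) (m : ℤ) :
    circleWord α ℓ (x + m) = circleWord α ℓ x := by
  funext k
  simp only [circleWord, circleLetter]
  rw [add_right_comm, Int.fract_add_intCast]

lemma circlePairs_add_intCast (α : ℝ) (ℓ : ℕ) (t : ℝ) (m : ℤ) :
    circlePairs α ℓ (t + m) = circlePairs α ℓ t := by
  simp only [circlePairs, ← add_assoc, circleWord_add_intCast]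

lemma circleWord_eq_of_floor {α : ℝ} (hα0 : 0 < α) (hα1 : α < 1) {ℓ : ℕ} {x y : ℝ}
    (h : ∀ k : ℕ, k ≤ ℓ → ⌊x + k * α⌋ = ⌊y + k * α⌋) :
    circleWord α ℓ x = circleWord α ℓ y := by
  have h0 := h 0 (by omega)
  simp only [Nat.cast_zero, zero_mul, add_zero] at h0
  exact (circleWord_eq_iff hα0 hα1 ℓ x y).2 fun k hk => by rw [h k hk, h0]

/-- Two points coded differently are separated by a point of the backward orbit of `0`. -/
lemma exists_between_of_circleWord_ne {α : ℝ} (hα0 : 0 < α) (hα1 : α < 1) {ℓ : ℕ} {x y : ℝ}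
    (hxy : x ≤ y) (h : circleWord α ℓ x ≠ circleWord α ℓ y) :
    ∃ k : ℕ, k ≤ ℓ ∧ ∃ m : ℤ, x < m - k * α ∧ m - k * α ≤ y := by
  by_contra! hc
  refine h (circleWord_eq_of_floor hα0 hα1 fun k hk => ?_)
  refine le_antisymm (Int.floor_mono (by linarith)) (Int.le_floor.2 ?_)
  by_contra! hlt
  have := hc k hk ⌊y + k * α⌋ (by linarith)
  linarith [Int.floor_le (y + k * α)]

lemma exists_floor_right (α : ℝ) (ℓ : ℕ) (x : ℝ) :
    ∃ ε > 0, ∀ δ : ℝ, 0 ≤ δ → δ < ε → ∀ k : ℕ, k ≤ ℓ → ⌊x + δ + k * α⌋ = ⌊x + k * α⌋ := by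
  obtain ⟨ε, hε, h⟩ := exists_pos_forall_of_antitone (ι := Fin (ℓ + 1))
    (P := fun k ε => ∀ δ : ℝ, 0 ≤ δ → δ < ε → ⌊x + δ + k * α⌋ = ⌊x + k * α⌋)
    (fun i ε ε' hle hP δ h0 h1 => hP δ h0 (h1.trans_le hle))
    (fun k => by
      refine ⟨⌊x + k * α⌋ + 1 - (x + k * α), by linarith [Int.lt_floor_add_one (x + k * α)],
        fun δ h0 h1 => ?_⟩
      rw [Int.floor_eq_iff]
      constructor <;> linarith [Int.floor_le (x + k * α)])
  exact ⟨ε, hε, fun δ h0 h1 k hk => h ⟨k, by omega⟩ δ h0 h1⟩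

lemma exists_floor_left (α : ℝ) (ℓ : ℕ) (x : ℝ) :
    ∃ ε > 0, ∀ δ : ℝ, 0 < δ → δ ≤ ε → ∀ k : ℕ, k ≤ ℓ → ⌊x - δ + k * α⌋ = ⌈x + k * α⌉ - 1 := by
  obtain ⟨ε, hε, h⟩ := exists_pos_forall_of_antitone (ι := Fin (ℓ + 1))
    (P := fun k ε => ∀ δ : ℝ, 0 < δ → δ ≤ ε → ⌊x - δ + k * α⌋ = ⌈x + k * α⌉ - 1)
    (fun i ε ε' hle hP δ h0 h1 => hP δ h0 (h1.trans hle))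
    (fun k => by
      refine ⟨x + k * α + 1 - ⌈x + k * α⌉, by linarith [Int.ceil_lt_add_one (x + k * α)],
        fun δ h0 h1 => ?_⟩
      rw [Int.floor_eq_iff]
      push_cast
      constructor <;> linarith [Int.le_ceil (x + k * α)])
  exact ⟨ε, hε, fun δ h0 h1 k hk => h ⟨k, by omega⟩ δ h0 h1⟩

lemma exists_circleWord_right {α : ℝ} (hα0 : 0 < α) (hα1 : α < 1) (ℓ : ℕ) (x : ℝ) :
    ∃ ε > 0, ∀ δ : ℝ, 0 ≤ δ → δ < ε → circleWord α ℓ (x + δ) = circleWord α ℓ x := by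
  obtain ⟨ε, hε, h⟩ := exists_floor_right α ℓ x
  exact ⟨ε, hε, fun δ h0 h1 => circleWord_eq_of_floor hα0 hα1 (h δ h0 h1)⟩

lemma sturmian_eq_circleLetter (α ρ : ℝ) (n : ℕ) :
    sturmian α ρ n = circleLetter α (ρ + n * α) := rfl

lemma boundarySet_sturmian {α : ℝ} (hα0 : 0 < α) (hα1 : α < 1) (hirr : Irrational α) (ρ : ℝ)
    (ℓ n : ℕ) : boundarySet (sturmian α ρ) ℓ n = circlePairs α ℓ (n * α) := by
  have e : ∀ i : ℕ, (fun k : Fin ℓ => sturmian α ρ (i + k)) = circleWord α ℓ (ρ + i * α) := by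
    intro i; funext k
    rw [sturmian_eq_circleLetter, circleWord]
    push_cast; ring_nf
  ext p
  simp only [boundarySet, circlePairs, Set.mem_ofPred_eq, ← funext_iff (f := p.1),
    ← funext_iff (f := p.2), e]
  constructor
  · rintro ⟨i, h1, h2⟩
    refine ⟨_, h1, h2.trans ?_⟩
    push_cast; ring_nf
  · rintro ⟨x, h1, h2⟩
    obtain ⟨ε, hε, hx⟩ := exists_circleWord_right hα0 hα1 ℓ x
    obtain ⟨ε', hε', hx'⟩ := exists_circleWord_right hα0 hα1 ℓ (x + n * α)
    obtain ⟨C, hC⟩ := exists_fract_add_mul_lt hirr (lt_min hε hε')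
    obtain ⟨i, -, hi⟩ := hC (ρ - x)
    set y := ρ - x + i * α with hy
    have h0 := Int.fract_nonneg y
    have hf := Int.floor_add_fract y
    refine ⟨i, ?_, ?_⟩
    · rw [h1, ← hx _ h0 (hi.trans_le (min_le_left _ _)),
        ← circleWord_add_intCast α ℓ (x + Int.fract y) ⌊y⌋]
      congr 1; linarith
    · rw [h2, ← hx' _ h0 (hi.trans_le (min_le_right _ _)),
        ← circleWord_add_intCast α ℓ (x + n * α + Int.fract y) ⌊y⌋]
      congr 1; push_cast; linarith

lemma exists_circlePairs_subset {α : ℝ} (hα0 : 0 < α) (hα1 : α < 1) (ℓ : ℕ) (t : ℝ) :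
    ∃ ε > 0, ∀ t' : ℝ, |t' - t| < ε → circlePairs α ℓ t ⊆ circlePairs α ℓ t' := by
  obtain ⟨ε, hε, h⟩ := exists_pos_forall_of_antitone (ι := circlePairs α ℓ t)
    (P := fun p ε => ∀ t' : ℝ, |t' - t| < ε → p.1 ∈ circlePairs α ℓ t')
    (fun i ε ε' hle hP δ h => hP δ (h.trans_le hle))
    (by
      rintro ⟨p, x, h1, h2⟩
      obtain ⟨ε, hε, hx⟩ := exists_circleWord_right hα0 hα1 ℓ x
      obtain ⟨ε', hε', hx'⟩ := exists_circleWord_right hα0 hα1 ℓ (x + t)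
      set η := min ε ε'
      have hη0 : 0 < η := lt_min hε hε'
      have hη1 : η ≤ ε := min_le_left _ _
      have hη2 : η ≤ ε' := min_le_right _ _
      refine ⟨η / 2, by positivity, fun t' ht' => ⟨x + η / 2, ?_, ?_⟩⟩
      · exact h1.trans (hx _ (by positivity) (by linarith)).symm
      · rw [abs_lt] at ht'
        refine h2.trans ?_
        rw [show x + η / 2 + t' = x + t + (η / 2 + (t' - t)) by ring,
          hx' _ (by linarith) (by linarith)])
  exact ⟨ε, hε, fun t' ht' p hp => h ⟨p, hp⟩ t' ht'⟩

lemma exists_pos_abs_add_intCast (θ : ℝ) : ∃ ε > 0, ∀ M : ℤ, |θ + M| < ε → θ + M = 0 := by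
  have hf := Int.floor_add_fract θ
  have h1 := Int.fract_lt_one θ
  rcases (Int.fract_nonneg θ).eq_or_lt with h0 | h0
  · refine ⟨1, one_pos, fun M hM => ?_⟩
    have e : θ + M = ((⌊θ⌋ + M : ℤ) : ℝ) := by push_cast; linarith
    rw [e] at hM ⊢
    exact_mod_cast Int.abs_lt_one_iff.1 (by exact_mod_cast hM)
  · refine ⟨min (Int.fract θ) (1 - Int.fract θ), lt_min h0 (by linarith), fun M hM => ?_⟩
    exfalso
    rw [lt_min_iff, abs_lt, abs_lt] at hM
    rcases le_or_gt 0 (⌊θ⌋ + M) with h | h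
    · have : (0 : ℝ) ≤ ⌊θ⌋ + M := by exact_mod_cast h
      linarith [hM.1.2]
    · have : (⌊θ⌋ + M : ℝ) ≤ -1 := by exact_mod_cast (show ⌊θ⌋ + M ≤ -1 by omega)
      linarith [hM.2.1]

lemma exists_pos_separation {α : ℝ} (hirr : Irrational α) (ℓ n : ℕ) :
    ∃ ε > 0, ∀ j k : ℕ, j ≤ ℓ → k ≤ ℓ → ∀ M : ℤ, |((j : ℝ) - k) * α + M - n * α| < ε →
      (j : ℤ) - k = n ∧ M = 0 := by
  obtain ⟨ε, hε, h⟩ := exists_pos_forall_of_antitone (ι := Fin (ℓ + 1) × Fin (ℓ + 1))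
    (P := fun p ε => ∀ M : ℤ, |((p.1 : ℝ) - (p.2 : ℕ)) * α + M - n * α| < ε →
      ((p.1 : ℕ) : ℤ) - (p.2 : ℕ) = n ∧ M = 0)
    (fun i ε ε' hle hP M hM => hP M (hM.trans_le hle))
    (by
      rintro ⟨j, k⟩
      obtain ⟨ε, hε, h⟩ := exists_pos_abs_add_intCast (((j : ℝ) - (k : ℕ) - n) * α)
      refine ⟨ε, hε, fun M hM => ?_⟩
      have h0 := h M (by convert hM using 2; ring)
      by_cases hd : ((j : ℕ) : ℤ) - (k : ℕ) - n = 0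
      · have hd' : ((j : ℝ) - (k : ℕ) - n) = 0 := by exact_mod_cast hd
        rw [hd', zero_mul, zero_add] at h0
        exact ⟨by linarith, by exact_mod_cast h0⟩
      · exfalso
        refine (hirr.intCast_mul hd).ne_int (-M) ?_
        push_cast
        linarith)
  exact ⟨ε, hε, fun j k hj hk => h (⟨j, by omega⟩, ⟨k, by omega⟩)⟩

lemma exists_between_of_mem_right {α : ℝ} (hα0 : 0 < α) (hα1 : α < 1) {ℓ : ℕ} {t t' x : ℝ}
    (htt' : t ≤ t') (h : (circleWord α ℓ x, circleWord α ℓ (x + t')) ∉ circlePairs α ℓ t) :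
    ∃ j k : ℕ, j ≤ ℓ ∧ k ≤ ℓ ∧ ∃ m' m : ℤ, x < m' - j * α ∧ m' - j * α ≤ x + (t' - t) ∧
      x + t < m - k * α ∧ m - k * α ≤ x + t' := by
  have h1 : circleWord α ℓ (x + t) ≠ circleWord α ℓ (x + t') := fun e => h ⟨x, rfl, e.symm⟩
  have h2 : circleWord α ℓ x ≠ circleWord α ℓ (x + (t' - t)) := fun e =>
    h ⟨x + (t' - t), e, by dsimp only; congr 1; ring⟩
  obtain ⟨k, hk, m, hm⟩ := exists_between_of_circleWord_ne hα0 hα1 (by linarith) h1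
  obtain ⟨j, hj, m', hm'⟩ := exists_between_of_circleWord_ne hα0 hα1 (by linarith) h2
  exact ⟨j, k, hj, hk, m', m, hm'.1, hm'.2, hm.1, hm.2⟩

lemma exists_between_of_mem_left {α : ℝ} (hα0 : 0 < α) (hα1 : α < 1) {ℓ : ℕ} {t t' x : ℝ}
    (htt' : t' ≤ t) (h : (circleWord α ℓ x, circleWord α ℓ (x + t')) ∉ circlePairs α ℓ t) :
    ∃ j k : ℕ, j ≤ ℓ ∧ k ≤ ℓ ∧ ∃ m' m : ℤ, x + (t' - t) < m' - j * α ∧ m' - j * α ≤ x ∧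
      x + t' < m - k * α ∧ m - k * α ≤ x + t := by
  have h1 : circleWord α ℓ (x + t') ≠ circleWord α ℓ (x + t) := fun e => h ⟨x, rfl, e⟩
  have h2 : circleWord α ℓ (x + (t' - t)) ≠ circleWord α ℓ x := fun e =>
    h ⟨x + (t' - t), e.symm, by dsimp only; congr 1; ring⟩
  obtain ⟨k, hk, m, hm⟩ := exists_between_of_circleWord_ne hα0 hα1 (by linarith) h1
  obtain ⟨j, hj, m', hm'⟩ := exists_between_of_circleWord_ne hα0 hα1 (by linarith) h2
  exact ⟨j, k, hj, hk, m', m, hm'.1, hm'.2, hm.1, hm.2⟩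

lemma exists_circlePairs_eq {α : ℝ} (hα0 : 0 < α) (hα1 : α < 1) (hirr : Irrational α)
    {ℓ n : ℕ} (hn : ℓ < n) :
    ∃ ε > 0, ∀ t : ℝ, |t - n * α| < ε → circlePairs α ℓ t = circlePairs α ℓ (n * α) := by
  obtain ⟨ε, hε, hsub⟩ := exists_circlePairs_subset hα0 hα1 ℓ (n * α)
  obtain ⟨ε', hε', hsep⟩ := exists_pos_separation hirr ℓ n
  refine ⟨min ε ε', lt_min hε hε', fun t ht => Set.Subset.antisymm ?_
    (hsub t (ht.trans_le (min_le_left _ _)))⟩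
  rintro ⟨p, q⟩ ⟨x, rfl, rfl⟩
  by_contra hx
  replace ht := abs_lt.1 (ht.trans_le (min_le_right _ _))
  have key : ∀ j k : ℕ, j ≤ ℓ → k ≤ ℓ → ∀ m' m : ℤ,
      ¬ |(m - k * α) - (m' - j * α) - n * α| < ε' := fun j k hj hk m' m hlt => by
    have := (hsep j k hj hk (m - m') (by push_cast; convert hlt using 2; ring)).1
    omega
  rcases le_total (n * α) t with h | h
  · obtain ⟨j, k, hj, hk, m', m, h1, h2, h3, h4⟩ := exists_between_of_mem_right hα0 hα1 h hx
    exact key j k hj hk m' m (abs_lt.2 ⟨by linarith, by linarith⟩)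
  · obtain ⟨j, k, hj, hk, m', m, h1, h2, h3, h4⟩ := exists_between_of_mem_left hα0 hα1 h hx
    exact key j k hj hk m' m (abs_lt.2 ⟨by linarith, by linarith⟩)

lemma circleWord_eq_zero_iff {α : ℝ} (hα0 : 0 < α) (ℓ : ℕ) (x : ℝ) :
    circleWord α ℓ x = 0 ↔ ∃ N : ℤ, N ≤ x ∧ x + ℓ * α < N + 1 := by
  have e : ∀ k : ℕ, x + k * α + α = x + (k + 1 : ℕ) * α := fun k => by push_cast; ring
  constructor
  · intro h
    have hk : ∀ k : ℕ, k ≤ ℓ → ⌊x + k * α⌋ = ⌊x⌋ := fun k => by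
      induction k with
      | zero => simp
      | succ k ih =>
        intro hk
        have := (circleLetter_eq_zero_iff hα0 _).1 (congrFun h ⟨k, hk⟩)
        simp only [e] at this
        rw [this, ih (by omega)]
    have h1 := hk ℓ le_rfl
    exact ⟨⌊x⌋, Int.floor_le x, h1 ▸ Int.lt_floor_add_one (x + ℓ * α)⟩
  · rintro ⟨N, h1, h2⟩
    have hk : ∀ k : ℕ, k ≤ ℓ → ⌊x + k * α⌋ = N := fun k hk => by
      have : (k : ℝ) * α ≤ ℓ * α := by gcongr
      have : 0 ≤ (k : ℝ) * α := by positivity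
      rw [Int.floor_eq_iff]
      constructor <;> linarith
    funext k
    refine (circleLetter_eq_zero_iff hα0 _).2 ?_
    rw [e, hk _ k.2, hk _ k.2.le]

lemma circleWord_eq_one_iff {α : ℝ} (hα0 : 0 < α) (hα1 : α < 1) (ℓ : ℕ) (x : ℝ) :
    circleWord α ℓ x = 1 ↔ ∃ N : ℤ, x < N ∧ N - 1 + ℓ * (1 - α) ≤ x := by
  have e : ∀ k : ℕ, x + k * α + α = x + (k + 1 : ℕ) * α := fun k => by push_cast; ring
  constructor
  · intro h
    have hk : ∀ k : ℕ, k ≤ ℓ → ⌊x + k * α⌋ = ⌊x⌋ + k := fun k => by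
      induction k with
      | zero => simp
      | succ k ih =>
        intro hk
        have := (circleLetter_eq_one_iff hα0 hα1 _).1 (congrFun h ⟨k, hk⟩)
        simp only [e] at this
        rw [this, ih (by omega)]
        push_cast; ring
    have h1 := Int.floor_le (x + ℓ * α)
    rw [hk ℓ le_rfl] at h1
    refine ⟨⌊x⌋ + 1, ?_, ?_⟩
    · exact_mod_cast Int.lt_floor_add_one x
    · push_cast at h1 ⊢
      linarith
  · rintro ⟨N, h1, h2⟩
    have hk : ∀ k : ℕ, k ≤ ℓ → ⌊x + k * α⌋ = N - 1 + k := fun k hk => by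
      have : (k : ℝ) * (1 - α) ≤ ℓ * (1 - α) := by gcongr
      have : 0 ≤ (k : ℝ) * (1 - α) := mul_nonneg (by positivity) (by linarith)
      rw [Int.floor_eq_iff]
      push_cast
      constructor <;> linarith
    funext k
    refine (circleLetter_eq_one_iff hα0 hα1 _).2 ?_
    rw [e, hk _ k.2, hk _ k.2.le]
    push_cast; ring

lemma zero_mem_circlePairs {α : ℝ} (hα0 : 0 < α) {ℓ : ℕ} (h : 2 * ℓ * α < 1) :
    ((0, 0) : (Fin ℓ → Fin 2) × (Fin ℓ → Fin 2)) ∈ circlePairs α ℓ (ℓ * α) := by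
  have : 0 ≤ ℓ * α := by positivity
  refine ⟨0, Eq.symm ?_, Eq.symm ?_⟩ <;> rw [circleWord_eq_zero_iff hα0] <;>
    refine ⟨0, ?_, ?_⟩ <;> push_cast <;> linarith

lemma one_mem_circlePairs {α : ℝ} (hα0 : 0 < α) (hα1 : α < 1) {ℓ : ℕ}
    (h : 2 * ℓ * (1 - α) < 1) :
    ((1, 1) : (Fin ℓ → Fin 2) × (Fin ℓ → Fin 2)) ∈ circlePairs α ℓ (ℓ * α) := by
  have : 0 ≤ ℓ * (1 - α) := mul_nonneg (by positivity) (by linarith)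
  refine ⟨2 * ℓ * (1 - α) - 1, Eq.symm ?_, Eq.symm ?_⟩ <;> rw [circleWord_eq_one_iff hα0 hα1]
  · refine ⟨0, ?_, ?_⟩ <;> push_cast <;> linarith
  · refine ⟨ℓ, ?_, ?_⟩ <;> push_cast <;> linarith

lemma exists_circlePairs_right {α : ℝ} (hα0 : 0 < α) (hα1 : α < 1) (hirr : Irrational α)
    {ℓ : ℕ} (h : 2 * ℓ * α < 1) :
    ∃ ε > 0, ∀ δ : ℝ, 0 ≤ δ → δ < ε →
      circlePairs α ℓ (ℓ * α + δ) = circlePairs α ℓ (ℓ * α) := by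
  obtain ⟨ε, hε, hsub⟩ := exists_circlePairs_subset hα0 hα1 ℓ (ℓ * α)
  obtain ⟨ε', hε', hsep⟩ := exists_pos_separation hirr ℓ ℓ
  have hp : 0 ≤ ℓ * α := by positivity
  refine ⟨min (1 - 2 * ℓ * α) (min ε ε'), lt_min (by linarith) (lt_min hε hε'),
    fun δ h0 hδ => ?_⟩
  simp only [lt_min_iff] at hδ
  refine Set.Subset.antisymm ?_ (hsub _ (by rw [add_sub_cancel_left, abs_of_nonneg h0]; tauto))
  rintro ⟨p, q⟩ ⟨x, rfl, rfl⟩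
  by_contra hx
  obtain ⟨j, k, hj, hk, m', m, h1, h2, h3, h4⟩ :=
    exists_between_of_mem_right hα0 hα1 (by linarith) hx
  have hs := hsep j k hj hk (m - m') (by
    push_cast; rw [abs_lt]; constructor <;> linarith [hδ.2.2])
  obtain rfl : k = 0 := by omega
  rw [Nat.cast_zero, zero_mul, sub_zero] at h3 h4
  refine hx ?_
  have e1 : circleWord α ℓ x = 0 := (circleWord_eq_zero_iff hα0 ℓ x).2
    ⟨m - 1, by push_cast; linarith [hδ.1], by push_cast; linarith⟩
  have e2 : circleWord α ℓ (x + (ℓ * α + δ)) = 0 := (circleWord_eq_zero_iff hα0 ℓ _).2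
    ⟨m, by linarith, by linarith [hδ.1]⟩
  rw [e1, e2]
  exact zero_mem_circlePairs hα0 h

lemma exists_circlePairs_left {α : ℝ} (hα0 : 0 < α) (hα1 : α < 1) (hirr : Irrational α)
    {ℓ : ℕ} (h : 2 * ℓ * (1 - α) < 1) :
    ∃ ε > 0, ∀ δ : ℝ, 0 ≤ δ → δ < ε →
      circlePairs α ℓ (ℓ * α - δ) = circlePairs α ℓ (ℓ * α) := by
  obtain ⟨ε, hε, hsub⟩ := exists_circlePairs_subset hα0 hα1 ℓ (ℓ * α)
  obtain ⟨ε', hε', hsep⟩ := exists_pos_separation hirr ℓ ℓ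
  have hp : 0 ≤ ℓ * (1 - α) := mul_nonneg (by positivity) (by linarith)
  refine ⟨min (1 - 2 * ℓ * (1 - α)) (min ε ε'), lt_min (by linarith) (lt_min hε hε'),
    fun δ h0 hδ => ?_⟩
  simp only [lt_min_iff] at hδ
  refine Set.Subset.antisymm ?_ (hsub _ (by
    rw [sub_sub_cancel_left, abs_neg, abs_of_nonneg h0]; tauto))
  rintro ⟨p, q⟩ ⟨x, rfl, rfl⟩
  by_contra hx
  obtain ⟨j, k, hj, hk, m', m, h1, h2, h3, h4⟩ :=
    exists_between_of_mem_left hα0 hα1 (by linarith) hx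
  have hs := hsep j k hj hk (m - m') (by
    push_cast; rw [abs_lt]; constructor <;> linarith [hδ.2.2])
  obtain rfl : k = 0 := by omega
  rw [Nat.cast_zero, zero_mul, sub_zero] at h3 h4
  refine hx ?_
  have e1 : circleWord α ℓ x = 1 := (circleWord_eq_one_iff hα0 hα1 ℓ x).2
    ⟨m - ℓ + 1, by push_cast; linarith [hδ.1], by push_cast; linarith⟩
  have e2 : circleWord α ℓ (x + (ℓ * α - δ)) = 1 := (circleWord_eq_one_iff hα0 hα1 ℓ _).2
    ⟨m, by linarith, by linarith [hδ.1]⟩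
  rw [e1, e2]
  exact one_mem_circlePairs hα0 hα1 h

lemma floor_eq_of_circleWord_eq {α : ℝ} (hα0 : 0 < α) (hα1 : α < 1) {ℓ : ℕ} {x y : ℝ}
    (hx0 : 0 ≤ x) (hx1 : x < 1) (hy0 : 0 ≤ y) (hy1 : y < 1)
    (h : circleWord α ℓ x = circleWord α ℓ y) (k : ℕ) (hk : k ≤ ℓ) :
    ⌊x + k * α⌋ = ⌊y + k * α⌋ := by
  have := (circleWord_eq_iff hα0 hα1 ℓ x y).1 h k hk
  rw [Int.floor_eq_zero_iff.2 ⟨hx0, hx1⟩, Int.floor_eq_zero_iff.2 ⟨hy0, hy1⟩] at this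
  omega

lemma circleWord_eq_of_between {α : ℝ} (hα0 : 0 < α) (hα1 : α < 1) {ℓ : ℕ} {x y z : ℝ}
    (hx0 : 0 ≤ x) (hxz : x ≤ z) (hzy : z ≤ y) (hy1 : y < 1)
    (h : circleWord α ℓ x = circleWord α ℓ y) : circleWord α ℓ z = circleWord α ℓ y := by
  refine circleWord_eq_of_floor hα0 hα1 fun k hk => ?_
  have := floor_eq_of_circleWord_eq hα0 hα1 hx0 (by linarith) (by linarith) hy1 h k hk
  have h1 : ⌊x + k * α⌋ ≤ ⌊z + k * α⌋ := Int.floor_mono (by linarith)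
  have h2 : ⌊z + k * α⌋ ≤ ⌊y + k * α⌋ := Int.floor_mono (by linarith)
  omega

lemma exists_circleWord_left {α : ℝ} (hα0 : 0 < α) (hα1 : α < 1) (ℓ : ℕ) (x : ℝ) :
    ∃ ε > 0, ∀ δ δ' : ℝ, 0 < δ → δ ≤ ε → 0 < δ' → δ' ≤ ε →
      circleWord α ℓ (x - δ) = circleWord α ℓ (x - δ') := by
  obtain ⟨ε, hε, h⟩ := exists_floor_left α ℓ x
  exact ⟨ε, hε, fun δ δ' h0 h1 h0' h1' => circleWord_eq_of_floor hα0 hα1 fun k hk => by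
    rw [h δ h0 h1 k hk, h δ' h0' h1' k hk]⟩

lemma exists_fract_witness {α : ℝ} {ℓ : ℕ} {t : ℝ} {u v : Fin ℓ → Fin 2}
    (h : (u, v) ∈ circlePairs α ℓ t) :
    ∃ x y : ℝ, 0 ≤ x ∧ x < 1 ∧ 0 ≤ y ∧ y < 1 ∧ circleWord α ℓ x = u ∧ circleWord α ℓ y = v ∧
      ∃ N : ℤ, x + t = y + N := by
  obtain ⟨x, h1, h2⟩ := h
  refine ⟨Int.fract x, Int.fract (x + t), Int.fract_nonneg _, Int.fract_lt_one _,
    Int.fract_nonneg _, Int.fract_lt_one _, ?_, ?_, ⌊x + t⌋ - ⌊x⌋, ?_⟩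
  · rw [← circleWord_add_intCast α ℓ _ ⌊x⌋, Int.fract_add_floor]
    exact h1.symm
  · rw [← circleWord_add_intCast α ℓ _ ⌊x + t⌋, Int.fract_add_floor]
    exact h2.symm
  · push_cast
    linarith [Int.floor_add_fract x, Int.floor_add_fract (x + t)]

lemma two_mul_lt_one_of_mem {α : ℝ} (hα0 : 0 < α) (hα1 : α < 1) {ℓ : ℕ} (hℓ : 1 ≤ ℓ)
    {P η : ℝ} {M : ℤ} (hP0 : 0 < P) (hP1 : P < 1) (hM : P + ℓ * α = M) (hη : 0 < η)
    (hηP : η ≤ P) (hfl : ∀ k : ℕ, k ≤ ℓ → ⌊P - η + k * α⌋ = ⌈P + k * α⌉ - 1)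
    (h : (circleWord α ℓ (P - η), circleWord α ℓ 0) ∈ circlePairs α ℓ (ℓ * α)) :
    2 * ℓ * α < 1 := by
  obtain ⟨x, y, hx0, hx1, hy0, hy1, hx, hy, N, hN⟩ := exists_fract_witness h
  have fx := floor_eq_of_circleWord_eq hα0 hα1 hx0 hx1 (by linarith) (by linarith) hx
  have fy := floor_eq_of_circleWord_eq hα0 hα1 hy0 hy1 le_rfl one_pos hy
  simp only [zero_add] at fy
  have hxP : x < P := by
    have := fx ℓ le_rfl
    rw [hfl ℓ le_rfl, hM, Int.ceil_intCast, Int.floor_eq_iff] at this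
    push_cast at this
    linarith [this.2]
  have hyP : y < P := by
    have e : ⌊(ℓ : ℝ) * α⌋ = M - 1 := by
      rw [Int.floor_eq_iff]; push_cast; constructor <;> linarith
    have := fy ℓ le_rfl
    rw [e, Int.floor_eq_iff] at this
    push_cast at this
    linarith [this.2]
  have hN' : M - N = 1 := by
    have h1 : (0 : ℝ) < ((M - N : ℤ) : ℝ) := by push_cast; linarith
    have h2 : ((M - N : ℤ) : ℝ) < ((2 : ℤ) : ℝ) := by push_cast; linarith
    have h1' : (0 : ℤ) < M - N := by exact_mod_cast h1
    have h2' := Int.cast_lt.1 h2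
    omega
  have hN'' : (M : ℝ) - N = 1 := by exact_mod_cast hN'
  have key : ∀ k : ℕ, k ≤ ℓ → k * α < 1 → k * α < 1 / 2 := fun k hk hlt => by
    have h1 : ⌊x + k * α⌋ ≤ ⌊y + k * α⌋ := Int.floor_mono (by linarith)
    have h0 : ⌊(k : ℝ) * α⌋ = 0 := Int.floor_eq_zero_iff.2 ⟨by positivity, hlt⟩
    rw [fx k hk, fy k hk, hfl k hk, h0] at h1
    have : ⌈P + k * α⌉ ≤ 1 := by omega
    have := Int.ceil_le.1 this
    push_cast at this
    linarith
  have hα2 : α < 1 / 2 := by simpa using key 1 hℓ (by simpa using hα1)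
  have : ∀ k : ℕ, k ≤ ℓ → k * α < 1 / 2 := fun k => by
    induction k with
    | zero => intro; norm_num
    | succ k ih =>
      intro hk
      have := ih (by omega)
      exact key _ hk (by push_cast; linarith)
  linarith [this ℓ le_rfl]

lemma two_mul_one_sub_lt_one_of_mem {α : ℝ} (hα0 : 0 < α) (hα1 : α < 1) {ℓ : ℕ} (hℓ : 1 ≤ ℓ)
    {P η : ℝ} {M : ℤ} (hP0 : 0 < P) (hP1 : P < 1) (hM : P + ℓ * α = M) (hη : 0 < η)
    (hηP : η ≤ 1 - P) (hfl : ∀ k : ℕ, k ≤ ℓ → ⌊1 - η + k * α⌋ = ⌈1 + k * α⌉ - 1)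
    (h : (circleWord α ℓ P, circleWord α ℓ (1 - η)) ∈ circlePairs α ℓ (ℓ * α)) :
    2 * ℓ * (1 - α) < 1 := by
  obtain ⟨x, y, hx0, hx1, hy0, hy1, hx, hy, N, hN⟩ := exists_fract_witness h
  have fx := floor_eq_of_circleWord_eq hα0 hα1 hx0 hx1 hP0.le hP1 hx
  have fy := floor_eq_of_circleWord_eq hα0 hα1 hy0 hy1 (by linarith) (by linarith) hy
  have hyP : P ≤ y := by
    have h1 : ⌊P + ℓ * α⌋ ≤ ⌊1 - η + ℓ * α⌋ := Int.floor_mono (by linarith)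
    rw [← fy ℓ le_rfl, hM, Int.floor_intCast, Int.le_floor] at h1
    linarith
  have hxP : P ≤ x := by
    have := Int.floor_le (x + ℓ * α)
    rw [fx ℓ le_rfl, hM, Int.floor_intCast] at this
    linarith
  have hN' : M - N = 0 := by
    have h1 : ((-1 : ℤ) : ℝ) < ((M - N : ℤ) : ℝ) := by push_cast; linarith
    have h2 : ((M - N : ℤ) : ℝ) < ((1 : ℤ) : ℝ) := by push_cast; linarith
    have h1' := Int.cast_lt.1 h1
    have h2' := Int.cast_lt.1 h2
    omega
  have hN'' : (M : ℝ) - N = 0 := by exact_mod_cast hN'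
  have key : ∀ k : ℕ, k ≤ ℓ → k * (1 - α) < 1 → k * (1 - α) < 1 / 2 := fun k hk hlt => by
    have h1 : ⌊y + k * α⌋ ≤ ⌊x + k * α⌋ := Int.floor_mono (by linarith)
    have h0 : (k : ℤ) + 1 ≤ ⌈1 + k * α⌉ := by
      have : (k : ℤ) < ⌈1 + k * α⌉ := Int.lt_ceil.2 (by push_cast; linarith)
      omega
    rw [fx k hk, fy k hk, hfl k hk] at h1
    have : (k : ℤ) ≤ ⌊P + k * α⌋ := by omega
    have := Int.le_floor.1 this
    push_cast at this
    linarith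
  have hα2 : 1 - α < 1 / 2 := by simpa using key 1 hℓ (by simpa using hα0)
  have : ∀ k : ℕ, k ≤ ℓ → k * (1 - α) < 1 / 2 := fun k => by
    induction k with
    | zero => intro; norm_num
    | succ k ih =>
      intro hk
      have := ih (by omega)
      exact key _ hk (by push_cast; linarith)
  linarith [this ℓ le_rfl]

lemma two_mul_lt_one_or_of_circlePairs_eq {α : ℝ} (hα0 : 0 < α) (hα1 : α < 1)
    (hirr : Irrational α) {ℓ : ℕ} (hℓ : 1 ≤ ℓ) {t : ℝ}
    (h : circlePairs α ℓ t = circlePairs α ℓ (ℓ * α)) (ht : ∀ N : ℤ, t - ℓ * α ≠ N) :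
    2 * ℓ * α < 1 ∨ 2 * ℓ * (1 - α) < 1 := by
  set P := Int.fract (-(ℓ * α))
  have hM : P + ℓ * α = ((-⌊-(ℓ * α)⌋ : ℤ) : ℝ) := by
    push_cast
    linarith [Int.floor_add_fract (-(ℓ * α))]
  have hP1 : P < 1 := Int.fract_lt_one _
  have hP0 : 0 < P := Int.fract_pos.2 ((hirr.natCast_mul (by omega)).neg.ne_int _)
  generalize -⌊-(ℓ * α)⌋ = M at hM
  clear_value P
  obtain ⟨ε₁, hε₁, hl₁⟩ := exists_floor_left α ℓ P
  obtain ⟨ε₂, hε₂, hl₂⟩ := exists_floor_left α ℓ 1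
  obtain ⟨ε₃, hε₃, hw₁⟩ := exists_circleWord_left hα0 hα1 ℓ P
  obtain ⟨ε₄, hε₄, hw₂⟩ := exists_circleWord_left hα0 hα1 ℓ 1
  obtain ⟨η, hη, h1, h2, h3, h4, h5, h6⟩ : ∃ η > 0, η ≤ ε₁ ∧ η ≤ ε₂ ∧ η ≤ ε₃ ∧ η ≤ ε₄ ∧
      η ≤ P ∧ η ≤ 1 - P := by
    refine ⟨min ε₁ (min ε₂ (min ε₃ (min ε₄ (min P (1 - P))))), ?_, ?_⟩
    · simp only [gt_iff_lt, lt_min_iff]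
      exact ⟨hε₁, hε₂, hε₃, hε₄, hP0, by linarith⟩
    · simp only [← le_min_iff, le_refl]
  have hmem : (circleWord α ℓ (P - η), circleWord α ℓ (1 - η)) ∈ circlePairs α ℓ t := by
    rw [h]
    refine ⟨P - η, rfl, ?_⟩
    dsimp only
    rw [← circleWord_add_intCast α ℓ (1 - η) (M - 1)]
    congr 1
    push_cast; linarith
  obtain ⟨x, y, hx0, hx1, hy0, hy1, hx, hy, N, hN⟩ := exists_fract_witness hmem
  have hxP : x < P := by
    have := floor_eq_of_circleWord_eq hα0 hα1 hx0 hx1 (by linarith) (by linarith) hx ℓ le_rfl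
    rw [hl₁ η hη h1 ℓ le_rfl, hM, Int.ceil_intCast, Int.floor_eq_iff] at this
    push_cast at this
    linarith [this.2]
  obtain ⟨c, hc⟩ : ∃ c, c = (P - x) - (1 - y) := ⟨_, rfl⟩
  have htc : P + t = c + ((N + 1 : ℤ) : ℝ) := by push_cast; linarith
  rcases lt_trichotomy c 0 with hc0 | hc0 | hc0
  · refine Or.inr (two_mul_one_sub_lt_one_of_mem hα0 hα1 hℓ hP0 hP1 hM hη h6 (hl₂ η hη h2) ?_)
    rw [← h]
    refine ⟨P, rfl, ?_⟩
    dsimp only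
    have e : P + t = 1 + c + (N : ℤ) := by rw [htc]; push_cast; ring
    rw [e, circleWord_add_intCast]
    rcases le_total (1 - η) (1 + c) with hle | hle
    · have := hw₂ η (-c) hη h4 (by linarith) (by linarith)
      rwa [sub_neg_eq_add] at this
    · exact (circleWord_eq_of_between hα0 hα1 hy0 (by linarith) hle (by linarith) hy).symm
  · refine absurd ?_ (ht (N + 1 - M))
    push_cast at htc ⊢
    linarith
  · refine Or.inl (two_mul_lt_one_of_mem hα0 hα1 hℓ hP0 hP1 hM hη h5 (hl₁ η hη h1) ?_)
    rw [← h]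
    refine ⟨P - c, ?_, ?_⟩
    · dsimp only
      rcases le_total (P - η) (P - c) with hle | hle
      · exact hw₁ η c hη h3 hc0 (by linarith)
      · exact (circleWord_eq_of_between hα0 hα1 hx0 (by linarith) hle (by linarith) hx).symm
    · dsimp only
      rw [← circleWord_add_intCast α ℓ 0 (N + 1)]
      congr 1
      linarith

lemma exists_run_of_mem {α : ℝ} (hα0 : 0 < α) (hα1 : α < 1) (hirr : Irrational α) (ρ : ℝ)
    {ℓ : ℕ} {a : Fin 2}
    (h : ((fun _ => a, fun _ => a) : (Fin ℓ → Fin 2) × (Fin ℓ → Fin 2)) ∈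
      circlePairs α ℓ (ℓ * α)) :
    ∃ i : ℕ, ∀ j < 2 * ℓ, sturmian α ρ (i + j) = a := by
  rw [← boundarySet_sturmian hα0 hα1 hirr ρ] at h
  obtain ⟨i, h1, h2⟩ := h
  refine ⟨i, fun j hj => ?_⟩
  rcases lt_or_ge j ℓ with hjℓ | hjℓ
  · exact (h1 ⟨j, hjℓ⟩).symm
  · have := (h2 ⟨j - ℓ, by omega⟩).symm
    rwa [show i + ℓ + (j - ℓ) = i + j by omega] at this

lemma circleWord_eq_const_of_run {α ρ : ℝ} {L i : ℕ} {a : Fin 2}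
    (h : ∀ j < L, sturmian α ρ (i + j) = a) :
    circleWord α L (ρ + i * α) = fun _ => a := by
  funext k
  rw [← h k k.2, sturmian_eq_circleLetter, circleWord]
  push_cast; ring_nf

/-- for a Sturmian word `s` of irrational slope `α ∈ (0,1)` and intercept
`ρ`, and `ℓ ≥ 1`, the shifted `ℓ`-boundary sequence `n ↦ ∂_{s,ℓ}[n+ℓ+1]` is uniformly
recurrent, and the full `ℓ`-boundary sequence `n ↦ ∂_{s,ℓ}[n+ℓ]` is uniformly recurrent
iff `0^{2ℓ}` or `1^{2ℓ}` occurs in `s`. -/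
theorem stmt14 (α : ℝ) (hα0 : 0 < α) (hα1 : α < 1) (hirr : Irrational α)
    (ρ : ℝ) (hρ0 : 0 ≤ ρ) (hρ1 : ρ < 1) (ℓ : ℕ) (hℓ : 1 ≤ ℓ) :
    UniformlyRecurrent (fun n : ℕ => boundarySet (sturmian α ρ) ℓ (n + ℓ + 1)) ∧
    (UniformlyRecurrent (fun n : ℕ => boundarySet (sturmian α ρ) ℓ (n + ℓ)) ↔
      ((∃ i : ℕ, ∀ j < 2 * ℓ, sturmian α ρ (i + j) = 0) ∨
        (∃ i : ℕ, ∀ j < 2 * ℓ, sturmian α ρ (i + j) = 1))) := by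
  simp only [boundarySet_sturmian hα0 hα1 hirr ρ]
  have hper := circlePairs_add_intCast α ℓ
  have hloc : ∀ n : ℕ, ℓ < n → ∀ σ : ℤ, (σ = 1 ∨ σ = -1) → ∃ ε > 0, ∀ δ : ℝ, 0 ≤ δ → δ < ε →
      circlePairs α ℓ (n * α + σ * δ) = circlePairs α ℓ (n * α) := fun n hn σ hσ => by
    obtain ⟨ε, hε, h⟩ := exists_circlePairs_eq hα0 hα1 hirr hn
    refine ⟨ε, hε, fun δ h0 h1 => h _ ?_⟩
    rw [add_sub_cancel_left]
    rcases hσ with rfl | rfl <;> simpa [abs_of_nonneg h0] using h1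
  refine ⟨?_, fun h => ?_, fun h => ?_⟩
  · exact UniformlyRecurrent.of_rotation hirr hper (ℓ + 1) (Or.inl rfl)
      fun n => hloc _ (by omega) 1 (Or.inl rfl)
  · obtain ⟨C, hC⟩ := h 0 1
    obtain ⟨j, hj, -, hk⟩ := hC 1
    have e := hk 0 one_pos
    simp only [add_zero, zero_add] at e
    rcases two_mul_lt_one_or_of_circlePairs_eq hα0 hα1 hirr hℓ e (fun N => by
      have := (hirr.natCast_mul (show j ≠ 0 by omega)).ne_int N
      push_cast
      rwa [add_mul, add_sub_cancel_right]) with h | h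
    · exact Or.inl (exists_run_of_mem hα0 hα1 hirr ρ (zero_mem_circlePairs hα0 h))
    · exact Or.inr (exists_run_of_mem hα0 hα1 hirr ρ (one_mem_circlePairs hα0 hα1 h))
  · obtain ⟨σ, hσ, ε, hε, hF⟩ : ∃ σ : ℤ, (σ = 1 ∨ σ = -1) ∧ ∃ ε > 0, ∀ δ : ℝ, 0 ≤ δ → δ < ε →
        circlePairs α ℓ (ℓ * α + σ * δ) = circlePairs α ℓ (ℓ * α) := by
      rcases h with ⟨i, hi⟩ | ⟨i, hi⟩
      · obtain ⟨N, h1, h2⟩ := (circleWord_eq_zero_iff hα0 _ _).1 (circleWord_eq_const_of_run hi)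
        push_cast at h2
        obtain ⟨ε, hε, h⟩ := exists_circlePairs_right hα0 hα1 hirr (ℓ := ℓ) (by linarith)
        exact ⟨1, Or.inl rfl, ε, hε, by simpa using h⟩
      · obtain ⟨N, h1, h2⟩ :=
          (circleWord_eq_one_iff hα0 hα1 _ _).1 (circleWord_eq_const_of_run hi)
        push_cast at h2
        obtain ⟨ε, hε, h⟩ := exists_circlePairs_left hα0 hα1 hirr (ℓ := ℓ) (by linarith)
        exact ⟨-1, Or.inr rfl, ε, hε, by simpa [← sub_eq_add_neg] using h⟩
    refine UniformlyRecurrent.of_rotation hirr hper ℓ hσ fun n => ?_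
    rcases n.eq_zero_or_pos with rfl | hn
    · rw [zero_add]
      exact ⟨ε, hε, hF⟩
    · exact hloc _ (by omega) σ hσ
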